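/- Let k be a field, K/k a purely inseparable field extension, and L/k an arbitrary field extension. Then the tensor product K ⊗_k L is a local ring. -/

import Mathlib

open TensorProduct

/-- A nontrivial algebra over a field in which every element has a positive power lying in the
base field is a local ring: its elements are units or nilpotent. -/
theorem isLocalRing_of_exists_pow_mem_range {F A : Type*} [Field F] [CommRing A] [Nontrivial A]
    [Algebra F A] (h : ∀ a : A, ∃ n > 0, a ^ n ∈ (algebraMap F A).range) :
    IsLocalRing A := by
  refine .of_isUnit_or_isUnit_one_sub_self fun a ↦ ?_
  obtain ⟨n, hn, c, hc⟩ := h a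
  rcases eq_or_ne c 0 with rfl | hc0
  · exact .inr (IsNilpotent.isUnit_one_sub ⟨n, by rw [← hc, map_zero]⟩)
  · exact .inl ((isUnit_pow_iff hn.ne').1 (hc ▸ (Ne.isUnit hc0).map (algebraMap F A)))

/-- If `K/k` is a purely inseparable field extension and `L/k` is an arbitrary
field extension, then `K ⊗[k] L` is a local ring. -/
theorem isLocalRing_tensorProduct_of_isPurelyInseparable
    (k K L : Type*) [Field k] [Field K] [Field L] [Algebra k K] [Algebra k L]
    [IsPurelyInseparable k K] :
    IsLocalRing (K ⊗[k] L) := by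
  have : IsLocalRing (L ⊗[k] K) :=
    isLocalRing_of_exists_pow_mem_range (F := L)
      IsPurelyInseparable.exists_pow_mem_range_tensorProduct
  exact (Algebra.TensorProduct.comm k L K).toRingEquiv.isLocalRing
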